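/- Let G be a δ-hyperbolic group and H a quasiconvex subgroup of infinite index in G. Then H contains no infinite normal subgroup of G; that is, every normal subgroup N ⊴ G with N ⊆ H is finite. -/

import Mathlib

open Pointwise

section WordMetric

variable {G : Type*} [Group G]

/-- The word length of `g` with respect to a generating set `S`: the length of a shortest
word in the letters of `S` representing `g`. -/
noncomputable def wordLength (S : Set G) (g : G) : ℕ :=
  sInf {n | ∃ l : List G, (∀ s ∈ l, s ∈ S) ∧ l.prod = g ∧ l.length = n}

/-- The word metric `d(x, y) = |x⁻¹ y|` associated with the generating set `S`,
viewed as a real number. -/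
noncomputable def wdist (S : Set G) (x y : G) : ℝ :=
  (wordLength S (x⁻¹ * y) : ℝ)

/-- The Gromov product `(x|y)_w = ½ (d(x,w) + d(y,w) − d(x,y))`. -/
noncomputable def gromovProd (S : Set G) (x y w : G) : ℝ :=
  (wdist S x w + wdist S y w - wdist S x y) / 2

/-- `z` lies between `x` and `y`: `d(x,z) + d(z,y) = d(x,y)`. -/
def LiesBetween (S : Set G) (x z y : G) : Prop :=
  wdist S x z + wdist S z y = wdist S x y

/-- `G` is `δ`-hyperbolic with respect to the word metric of `S`:
(i) the Gromov products satisfy the `δ`-inequality; (ii) triangles are `δ`-thin;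
(iii) triangles are `δ`-slim. -/
def IsHyperbolicWith (S : Set G) (δ : ℝ) : Prop :=
  (∀ x y z w : G,
      gromovProd S x y w ≥ min (gromovProd S x z w) (gromovProd S y z w) - δ) ∧
  (∀ x y z p q : G, LiesBetween S x p y → LiesBetween S x q z →
      wdist S x p = wdist S x q → wdist S x p ≤ gromovProd S y z x →
      wdist S p q ≤ δ) ∧
  (∀ x y z p : G, LiesBetween S x p y →
      ∃ q : G, (LiesBetween S x q z ∨ LiesBetween S z q y) ∧ wdist S p q ≤ δ)

/-- A subset `Q ⊆ G` is `ε`-quasiconvex: every point between two points of `Q`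
is at distance at most `ε` from `Q`. -/
def IsEpsQuasiconvex (S : Set G) (ε : ℝ) (Q : Set G) : Prop :=
  ∀ x ∈ Q, ∀ y ∈ Q, ∀ z : G, LiesBetween S x z y → ∃ q ∈ Q, wdist S z q ≤ ε

/-- A subset `Q ⊆ G` is quasiconvex if it is `ε`-quasiconvex for some `ε ≥ 0`. -/
def IsQuasiconvex (S : Set G) (Q : Set G) : Prop :=
  ∃ ε : ℝ, 0 ≤ ε ∧ IsEpsQuasiconvex S ε Q

/-- For subsets `B A` of a group `G`, `Prec B A` means `B ⪯ A`: there exist finitely many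
elements `x₁, …, xₙ ∈ G` with `B ⊆ A x₁ ∪ ⋯ ∪ A xₙ`. -/
def Prec (B A : Set G) : Prop :=
  ∃ T : Finset G, B ⊆ A * (T : Set G)

/-- `A ≈ B` : `A ⪯ B` and `B ⪯ A`. -/
def Approx (A B : Set G) : Prop :=
  Prec A B ∧ Prec B A

/-- A subset `A` is quasidense if `G ⪯ A`. -/
def Quasidense (A : Set G) : Prop :=
  Prec (Set.univ : Set G) A

/-- The conjugate subgroup `gHg⁻¹`. -/
def conjSubgroup (g : G) (H : Subgroup G) : Subgroup G :=
  H.map (MulAut.conj g).toMonoidHom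

/-- `H^G = {g h g⁻¹ : h ∈ H, g ∈ G}`, the union of all conjugates of `H`. -/
def conjUnion (H : Subgroup G) : Set G :=
  {x | ∃ g : G, ∃ h ∈ H, x = g * h * g⁻¹}

/-- The quasiconvex product `f₀ G₁ f₁ G₂ ⋯ f_{n−1} G_n f_n` determined by the subgroups
`H 0, …, H (n-1)` and the elements `f 0, …, f n`. -/
def quasiconvexProduct (n : ℕ) (f : Fin (n + 1) → G) (H : Fin n → Subgroup G) : Set G :=
  {x | ∃ g : Fin n → G, (∀ i, g i ∈ H i) ∧
        x = f 0 * (List.ofFn fun i : Fin n => g i * f i.succ).prod}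

end WordMetric

section WordLength

variable {G : Type*} [Group G] {S : Set G}

theorem exists_word_of_closure_eq_top (hsym : ∀ s ∈ S, s⁻¹ ∈ S)
    (hgen : Subgroup.closure S = ⊤) (g : G) :
    ∃ l : List G, (∀ s ∈ l, s ∈ S) ∧ l.prod = g := by
  have hmem : g ∈ (Subgroup.closure S).toSubmonoid := by simp [hgen]
  rw [Subgroup.closure_toSubmonoid] at hmem
  obtain ⟨l, hl, hg⟩ := Submonoid.exists_list_of_mem_closure hmem
  refine ⟨l, fun s hs => ?_, hg⟩
  rcases hl s hs with h | h
  · exact h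
  · simpa using hsym _ h

theorem exists_word_length_eq_wordLength (hsym : ∀ s ∈ S, s⁻¹ ∈ S)
    (hgen : Subgroup.closure S = ⊤) (g : G) :
    ∃ l : List G, (∀ s ∈ l, s ∈ S) ∧ l.prod = g ∧ l.length = wordLength S g := by
  obtain ⟨l, hl, hg⟩ := exists_word_of_closure_eq_top hsym hgen g
  exact Nat.sInf_mem
    (s := {n | ∃ l : List G, (∀ s ∈ l, s ∈ S) ∧ l.prod = g ∧ l.length = n})
    ⟨l.length, l, hl, hg, rfl⟩

theorem wordLength_prod_le {l : List G} (hl : ∀ s ∈ l, s ∈ S) :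
    wordLength S l.prod ≤ l.length :=
  Nat.sInf_le ⟨l, hl, rfl, rfl⟩

theorem wordLength_mul_le (hsym : ∀ s ∈ S, s⁻¹ ∈ S) (hgen : Subgroup.closure S = ⊤) (x y : G) :
    wordLength S (x * y) ≤ wordLength S x + wordLength S y := by
  obtain ⟨l, hl, hx, hlx⟩ := exists_word_length_eq_wordLength hsym hgen x
  obtain ⟨m, hm, hy, hmy⟩ := exists_word_length_eq_wordLength hsym hgen y
  have := wordLength_prod_le (S := S) (l := l ++ m) (by grind)
  simpa [hx, hy, hlx, hmy] using this

theorem wordLength_inv_le (hsym : ∀ s ∈ S, s⁻¹ ∈ S) (hgen : Subgroup.closure S = ⊤) (x : G) :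
    wordLength S x⁻¹ ≤ wordLength S x := by
  obtain ⟨l, hl, hx, hlx⟩ := exists_word_length_eq_wordLength hsym hgen x
  have := wordLength_prod_le (S := S) (l := (l.map (·⁻¹)).reverse) (by
    intro s hs
    obtain ⟨t, ht, rfl⟩ := by simpa only [List.mem_reverse, List.mem_map] using hs
    exact hsym t (hl t ht))
  rwa [← List.prod_inv_reverse, hx, List.length_reverse, List.length_map, hlx] at this

theorem wordLength_inv (hsym : ∀ s ∈ S, s⁻¹ ∈ S) (hgen : Subgroup.closure S = ⊤) (x : G) :
    wordLength S x⁻¹ = wordLength S x :=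
  le_antisymm (wordLength_inv_le hsym hgen x) (by simpa using wordLength_inv_le hsym hgen x⁻¹)

theorem exists_mul_eq_of_le_wordLength (hsym : ∀ s ∈ S, s⁻¹ ∈ S)
    (hgen : Subgroup.closure S = ⊤) (g : G) {k : ℕ} (hk : k ≤ wordLength S g) :
    ∃ u v : G, u * v = g ∧ wordLength S u = k ∧ wordLength S v + k = wordLength S g := by
  obtain ⟨l, hl, hg, hlg⟩ := exists_word_length_eq_wordLength hsym hgen g
  have huv : (l.take k).prod * (l.drop k).prod = g := by
    rw [← List.prod_append, List.take_append_drop, hg]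
  have h₁ := wordLength_prod_le (S := S) (l := l.take k) fun s hs => hl s (List.mem_of_mem_take hs)
  have h₂ := wordLength_prod_le (S := S) (l := l.drop k) fun s hs => hl s (List.mem_of_mem_drop hs)
  have h₃ := wordLength_mul_le hsym hgen (l.take k).prod (l.drop k).prod
  rw [huv] at h₃
  rw [List.length_take] at h₁
  rw [List.length_drop] at h₂
  exact ⟨_, _, huv, by omega, by omega⟩

theorem finite_wordLength_le (hfin : S.Finite) (hsym : ∀ s ∈ S, s⁻¹ ∈ S)
    (hgen : Subgroup.closure S = ⊤) (k : ℕ) : {g : G | wordLength S g ≤ k}.Finite := by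
  have hpow : ∀ n : ℕ, (S ^ n).Finite := fun n => by
    induction n with
    | zero => simp
    | succ n ih => exact pow_succ S n ▸ ih.mul hfin
  refine ((Set.finite_Iic k).biUnion fun n _ => hpow n).subset fun g hg => ?_
  obtain ⟨l, hl, rfl, hlg⟩ := exists_word_length_eq_wordLength hsym hgen g
  refine Set.mem_biUnion (x := l.length) (by simpa [hlg] using hg) ?_
  clear hg hlg
  induction l with
  | nil => simp
  | cons a l ih =>
    rw [List.prod_cons, List.length_cons, pow_succ']
    exact Set.mul_mem_mul (hl a (by simp)) (ih fun s hs => hl s (by simp [hs]))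

theorem wdist_comm (hsym : ∀ s ∈ S, s⁻¹ ∈ S) (hgen : Subgroup.closure S = ⊤) (x y : G) :
    wdist S x y = wdist S y x := by
  rw [wdist, wdist, ← wordLength_inv hsym hgen]
  simp

theorem wdist_triangle (hsym : ∀ s ∈ S, s⁻¹ ∈ S) (hgen : Subgroup.closure S = ⊤) (x y z : G) :
    wdist S x z ≤ wdist S x y + wdist S y z := by
  have := wordLength_mul_le hsym hgen (x⁻¹ * y) (y⁻¹ * z)
  rw [show x⁻¹ * y * (y⁻¹ * z) = x⁻¹ * z by group] at this
  unfold wdist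
  exact_mod_cast this

theorem wdist_mul_left (g x y : G) : wdist S (g * x) (g * y) = wdist S x y := by
  rw [wdist, wdist]
  congr 2
  group

theorem wdist_one_left (x : G) : wdist S 1 x = wordLength S x := by
  simp [wdist]

theorem exists_liesBetween_wdist_eq (hsym : ∀ s ∈ S, s⁻¹ ∈ S)
    (hgen : Subgroup.closure S = ⊤) (x y : G) {k : ℕ} (hk : (k : ℝ) ≤ wdist S x y) :
    ∃ z, LiesBetween S x z y ∧ wdist S x z = k := by
  obtain ⟨u, v, huv, hu, hv⟩ :=
    exists_mul_eq_of_le_wordLength hsym hgen (x⁻¹ * y) (k := k) (by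
      unfold wdist at hk; exact_mod_cast hk)
  have h₁ : wdist S x (x * u) = k := by simp [wdist, hu]
  have h₂ : wdist S (x * u) y = wordLength S v := by
    rw [wdist, show (x * u)⁻¹ * y = v by rw [mul_inv_rev, mul_assoc, ← huv, inv_mul_cancel_left]]
  refine ⟨x * u, ?_, h₁⟩
  rw [LiesBetween, h₁, h₂, wdist, ← hv]
  push_cast
  ring

end WordLength

section Hyperbolic

variable {G : Type*} [Group G] {S : Set G} {δ : ℝ}

/-- If all long elements of `N` issue from `1` in a common direction, then moving the base point
by `C` in that direction shortens every long element of `N`. -/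
theorem exists_wordLength_conj_lt_of_gromovProd_gt (hsym : ∀ s ∈ S, s⁻¹ ∈ S)
    (hgen : Subgroup.closure S = ⊤) (hhyp : IsHyperbolicWith S δ) {N : Subgroup G} {C R : ℕ}
    (hC : δ < C) (hR : 2 * C ≤ R) (hlong : ∃ p ∈ N, R < wordLength S p)
    (hdir : ∀ n ∈ N, ∀ n' ∈ N, R < wordLength S n → R < wordLength S n' →
      (C : ℝ) < gromovProd S n n' 1) :
    ∃ q : G, ∀ n ∈ N, wordLength S (q⁻¹ * n * q) ≤ R + 2 * C ∨
      wordLength S (q⁻¹ * n * q) < wordLength S n := by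
  obtain ⟨p, hpN, hp⟩ := hlong
  obtain ⟨q, hqp, hq⟩ := exists_liesBetween_wdist_eq hsym hgen 1 p (k := C) (by
    rw [wdist_one_left]; exact_mod_cast (by omega))
  have hqC : wordLength S q = C := by rw [wdist_one_left] at hq; exact_mod_cast hq
  have hclose : ∀ n ∈ N, R < wordLength S n → ∀ u v : G, u * v = n → wordLength S u = C →
      wordLength S v + C = wordLength S n → wdist S q u ≤ δ := by
    intro n hn hnR u v huv hu hv
    refine hhyp.2.1 1 p n q u hqp ?_ ?_ ?_
    · rw [LiesBetween, wdist_one_left, wdist_one_left, wdist, ← huv, inv_mul_cancel_left, huv,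
        ← hv, hu]
      push_cast
      ring
    · rw [hq, wdist_one_left, hu]
    · exact hq ▸ (hdir p hpN n hn hp hnR).le
  refine ⟨q, fun n hn => ?_⟩
  rcases le_or_gt (wordLength S n) R with hnR | hnR
  · left
    have h₁ := wordLength_mul_le hsym hgen (q⁻¹ * n) q
    have h₂ := wordLength_mul_le hsym hgen q⁻¹ n
    have h₃ := wordLength_inv hsym hgen q
    omega
  · right
    obtain ⟨u, x, hux, hu, hx⟩ := exists_mul_eq_of_le_wordLength hsym hgen n (k := C) (by omega)
    obtain ⟨v, w, hvw, hv, hw⟩ :=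
      exists_mul_eq_of_le_wordLength hsym hgen x (k := wordLength S x - C) (by omega)
    have hinv := wordLength_inv hsym hgen
    have hqu := hclose n hn hnR u x hux hu hx
    have hqw := hclose n⁻¹ (N.inv_mem hn) (by rwa [hinv]) w⁻¹ (u * v)⁻¹
      (by rw [← hux, ← hvw]; group) (by rw [hinv]; omega) (by
        have h₁ := wordLength_mul_le hsym hgen u v
        have h₂ := wordLength_mul_le hsym hgen (u * v) w
        rw [mul_assoc, hvw, hux] at h₂
        rw [hinv, hinv]
        omega)
    rw [wdist_comm hsym hgen] at hqw
    simp only [wdist, inv_inv] at hqu hqw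
    have h₁ := wordLength_mul_le hsym hgen (q⁻¹ * u) v
    have h₂ := wordLength_mul_le hsym hgen (q⁻¹ * u * v) (w * q)
    rw [show q⁻¹ * u * v * (w * q) = q⁻¹ * n * q by rw [← hux, ← hvw]; group] at h₂
    have h₃ : wordLength S (q⁻¹ * u) < C := by exact_mod_cast hqu.trans_lt hC
    have h₄ : wordLength S (w * q) < C := by exact_mod_cast hqw.trans_lt hC
    omega

/-- An infinite normal subgroup of a hyperbolic group has, for some constant `C`, pairs of
arbitrarily long elements whose Gromov product is at most `C`. -/
theorem exists_pair_gromovProd_le_of_infinite_normal (hfin : S.Finite)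
    (hsym : ∀ s ∈ S, s⁻¹ ∈ S) (hgen : Subgroup.closure S = ⊤) (hhyp : IsHyperbolicWith S δ)
    {N : Subgroup G} (hN : N.Normal) (hinf : (N : Set G).Infinite) :
    ∃ C : ℕ, ∀ R : ℕ, ∃ n ∈ N, ∃ n' ∈ N, R < wordLength S n ∧ R < wordLength S n' ∧
      gromovProd S n n' 1 ≤ C := by
  obtain ⟨C, hC⟩ := exists_nat_gt δ
  refine ⟨C, ?_⟩
  by_contra! hcon
  obtain ⟨R₀, hR₀⟩ := hcon
  set R := max R₀ (2 * C) with hR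
  have hlong : ∃ p ∈ N, R < wordLength S p := by
    by_contra! h
    exact hinf ((finite_wordLength_le hfin hsym hgen R).subset h)
  obtain ⟨q, hq⟩ := exists_wordLength_conj_lt_of_gromovProd_gt hsym hgen hhyp hC
    (le_max_right R₀ (2 * C)) hlong fun n hn n' hn' h h' =>
      hR₀ n hn n' hn' (lt_of_le_of_lt (le_max_left _ _) h) (lt_of_le_of_lt (le_max_left _ _) h')
  have hshort : ∀ k : ℕ, ∃ x : G, ∀ n ∈ N, wordLength S n ≤ R + 2 * C + k →
      wordLength S (x⁻¹ * n * x) ≤ R + 2 * C := by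
    intro k
    induction k with
    | zero => exact ⟨1, fun n _ h => by simpa using h⟩
    | succ k ih =>
      obtain ⟨x, hx⟩ := ih
      refine ⟨q * x, fun n hn h => ?_⟩
      have hconj : q⁻¹ * n * q ∈ N := by simpa using hN.conj_mem n hn q⁻¹
      have := hx _ hconj (by have := hq n hn; omega)
      rwa [show (q * x)⁻¹ * n * (q * x) = x⁻¹ * (q⁻¹ * n * q) * x by group]
  have hball := finite_wordLength_le hfin hsym hgen (R + 2 * C)
  obtain ⟨F, hFN, hFcard⟩ := hinf.exists_subset_card_eq (hball.toFinset.card + 1)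
  obtain ⟨x, hx⟩ := hshort (F.sup (wordLength S))
  have hle : F.card ≤ hball.toFinset.card :=
    Finset.card_le_card_of_injOn (fun n => x⁻¹ * n * x)
      (fun n hn => by
        have hnF : n ∈ F := hn
        simpa using hx n (hFN hn) ((Finset.le_sup (f := wordLength S) hnF).trans (by omega)))
      (fun a _ b _ hab => by simpa using hab)
  omega

theorem exists_gromovProd_le_of_infinite_normal (hfin : S.Finite)
    (hsym : ∀ s ∈ S, s⁻¹ ∈ S) (hgen : Subgroup.closure S = ⊤) (hhyp : IsHyperbolicWith S δ)
    {N : Subgroup G} (hN : N.Normal) (hinf : (N : Set G).Infinite) :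
    ∃ C : ℝ, ∀ (x : G) (R : ℕ), ∃ n ∈ N, R < wordLength S n ∧ gromovProd S n x 1 ≤ C := by
  obtain ⟨C, hC⟩ := exists_pair_gromovProd_le_of_infinite_normal hfin hsym hgen hhyp hN hinf
  refine ⟨C + δ, fun x R => ?_⟩
  obtain ⟨n, hn, n', hn', hR, hR', hle⟩ := hC R
  have := hhyp.1 n n' x 1
  rcases min_le_iff.1 (show min (gromovProd S n x 1) (gromovProd S n' x 1) ≤ C + δ by linarith)
    with h | h
  · exact ⟨n, hn, hR, h⟩
  · exact ⟨n', hn', hR', h⟩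

/-- In a thin triangle, the vertex `y` is close to the opposite side whenever the Gromov product
at `y` is small. -/
theorem exists_liesBetween_wdist_le (hsym : ∀ s ∈ S, s⁻¹ ∈ S) (hgen : Subgroup.closure S = ⊤)
    (hhyp : IsHyperbolicWith S δ) (x y z : G) :
    ∃ a, LiesBetween S x a z ∧ wdist S y a ≤ gromovProd S x z y + 1 + δ := by
  have hxy := wdist_comm hsym hgen x y
  have hxz := wdist_comm hsym hgen x z
  have hyz := wdist_comm hsym hgen y z
  have t₁ := wdist_triangle hsym hgen x y z
  have t₂ := wdist_triangle hsym hgen y x z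
  have t₃ := wdist_triangle hsym hgen x z y
  have hgp : gromovProd S y z x = wdist S x y - gromovProd S x z y := by
    unfold gromovProd; linarith
  have hgp' : gromovProd S y z x ≤ wdist S x z := by unfold gromovProd; linarith
  have hgp₁ : gromovProd S y z x ≤ wdist S x y := by unfold gromovProd; linarith
  have hgp₀ : 0 ≤ gromovProd S y z x := by unfold gromovProd; linarith
  have hfl := Nat.floor_le hgp₀
  have hlt := Nat.lt_floor_add_one (gromovProd S y z x)
  obtain ⟨a, ha, hxa⟩ := exists_liesBetween_wdist_eq hsym hgen x z (hfl.trans hgp')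
  obtain ⟨b, hb, hxb⟩ := exists_liesBetween_wdist_eq hsym hgen x y (hfl.trans hgp₁)
  have hba := hhyp.2.1 x y z b a hb ha (hxb.trans hxa.symm) (hxb ▸ hfl)
  have := wdist_triangle hsym hgen y b a
  have hyb := wdist_comm hsym hgen y b
  unfold LiesBetween at hb
  exact ⟨a, ha, by linarith⟩

/-- A shortest representative `g` of a coset `Hg` has bounded length, provided the normal subgroup
`N ≤ H` contains a long element `n` making a small Gromov product with `g⁻¹`. -/
theorem wordLength_le_of_minimal (hsym : ∀ s ∈ S, s⁻¹ ∈ S) (hgen : Subgroup.closure S = ⊤)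
    (hhyp : IsHyperbolicWith S δ) {ε C : ℝ} {H N : Subgroup G}
    (hH : IsEpsQuasiconvex S ε (H : Set G)) (hN : N.Normal) (hNH : N ≤ H) {g n : G}
    (hg : ∀ h ∈ H, wordLength S g ≤ wordLength S (h * g)) (hn : n ∈ N)
    (hlong : 2 * (C + 1 + 2 * δ) < wordLength S n) (hprod : gromovProd S n g⁻¹ 1 ≤ C) :
    (wordLength S g : ℝ) ≤ C + 1 + 2 * δ + ε := by
  have hmin : ∀ h ∈ H, (wordLength S g : ℝ) ≤ wdist S h g := fun h hh => by
    rw [wdist]; exact_mod_cast hg h⁻¹ (H.inv_mem hh)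
  obtain ⟨a, ha, hga⟩ := exists_liesBetween_wdist_le hsym hgen hhyp 1 g (g * n)
  have hprod' : gromovProd S 1 (g * n) g = gromovProd S n g⁻¹ 1 := by
    have h₁ := wdist_mul_left (S := S) g g⁻¹ 1
    have h₂ := wdist_mul_left (S := S) g n 1
    have h₃ := wdist_mul_left (S := S) g n g⁻¹
    rw [mul_inv_cancel, mul_one] at h₁
    rw [mul_one] at h₂
    rw [mul_inv_cancel, wdist_comm hsym hgen] at h₃
    rw [gromovProd, gromovProd, h₁, h₂, h₃]
    ring
  set m := g * n * g⁻¹ with hm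
  have hmH : m ∈ H := hNH (hN.conj_mem n hn g)
  have hmg : m * g = g * n := by simp [hm]
  obtain ⟨q, hq, haq⟩ := hhyp.2.2 1 (g * n) m a ha
  have hgq := wdist_triangle hsym hgen g a q
  rcases hq with hq | hq
  · obtain ⟨h, hh, hqh⟩ := hH 1 H.one_mem m hmH q hq
    have h₁ := wdist_triangle hsym hgen g q h
    have h₂ := hmin h hh
    rw [wdist_comm hsym hgen] at h₂
    linarith
  · exfalso
    have h₁ := hmin m hmH
    have h₂ := wdist_triangle hsym hgen m q g
    have h₃ := wdist_comm hsym hgen q g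
    have h₄ := wdist_triangle hsym hgen g q (g * n)
    have h₅ : wdist S m (g * n) = wordLength S g := by rw [← hmg, wdist, inv_mul_cancel_left]
    have h₆ : wdist S g (g * n) = wordLength S n := by rw [wdist, inv_mul_cancel_left]
    unfold LiesBetween at hq
    linarith

end Hyperbolic

theorem Subgroup.index_ne_zero_of_forall_exists_mul_mem {G : Type*} [Group G] (H : Subgroup G)
    {B : Set G} (hB : B.Finite) (h : ∀ x : G, ∃ y ∈ H, y * x ∈ B) : H.index ≠ 0 := by
  have := hB.to_subtype
  have : Finite (G ⧸ H) := by
    refine Finite.of_surjective (fun b : B => (((b : G)⁻¹ : G) : G ⧸ H)) fun x => ?_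
    obtain ⟨x, rfl⟩ := QuotientGroup.mk_surjective x
    obtain ⟨y, hy, hyx⟩ := h x⁻¹
    refine ⟨⟨_, hyx⟩, ?_⟩
    rw [QuotientGroup.eq]
    simpa using hy
  exact Subgroup.index_ne_zero_of_finite


/-- Let `G` be `δ`-hyperbolic and `H` a quasiconvex subgroup of infinite index in `G`
(`H.index = 0`).  Then every normal subgroup `N ⊴ G` with `N ⊆ H` is finite. -/
theorem quasiconvex_infinite_index_no_infinite_normal_subgroup
    {G : Type*} [Group G] (S : Set G) (hSfin : S.Finite)
    (hSsym : ∀ s ∈ S, s⁻¹ ∈ S) (hSgen : Subgroup.closure S = ⊤)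
    (δ : ℝ) (hδ : 0 ≤ δ) (hhyp : IsHyperbolicWith S δ)
    (H : Subgroup G) (hH : IsQuasiconvex S (H : Set G)) (hHidx : H.index = 0)
    (N : Subgroup G) (hN : N.Normal) (hNH : (N : Set G) ⊆ (H : Set G)) :
    (N : Set G).Finite := by
  by_contra hinf
  obtain ⟨ε, -, hε⟩ := hH
  obtain ⟨C, hC⟩ := exists_gromovProd_le_of_infinite_normal hSfin hSsym hSgen hhyp hN hinf
  obtain ⟨R, hR⟩ := exists_nat_ge (2 * (C + 1 + 2 * δ))
  obtain ⟨D, hD⟩ := exists_nat_ge (C + 1 + 2 * δ + ε)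
  refine H.index_ne_zero_of_forall_exists_mul_mem
    (finite_wordLength_le hSfin hSsym hSgen D) (fun x => ?_) hHidx
  let f : H → ℕ := fun z => wordLength S (z * x)
  set y : H := Function.argmin f
  refine ⟨y, y.2, ?_⟩
  obtain ⟨n, hn, hRn, hprod⟩ := hC (y * x)⁻¹ R
  have hlt : (R : ℝ) < wordLength S n := by exact_mod_cast hRn
  have hle := wordLength_le_of_minimal hSsym hSgen hhyp hε hN hNH
    (fun h hh => by
      rw [← mul_assoc]
      exact Function.argmin_le f (⟨h, hh⟩ * y)) hn (hR.trans_lt hlt) hprod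
  exact_mod_cast hle.trans hD
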